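/- Let n = 2r be an even integer with n ≥ 4, let F be a field, let C be a commutative F-algebra, and let Y ∈ V(C). Let k = 2m with 1 ≤ t ≤ m ≤ r, and let P', Q' ⊆ {1,…,r} with |P'| + |Q'| = k − 2t. Then 2^m · m! · t! · ∑_{Γ_t} [P' ∪ Γ_t, overline(Q' ∪ Γ_t)] = 0 in C, where Γ_t ranges over all subsets of {1,…,r} ∖ (P' ∪ Q') of size t. -/

import Mathlib

open scoped Matrix

noncomputable section

namespace PR

/-- The polynomial ring `R[Y_{ij} : 1 ≤ i, j ≤ n]`, `n = 2r`. -/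
abbrev PolyRing (r : ℕ) (R : Type*) [CommRing R] :=
  MvPolynomial (Fin (2 * r) × Fin (2 * r)) R

/-- The standard symplectic form matrix `J` (`n = 2r`). -/
def Jmat (r : ℕ) (R : Type*) [CommRing R] : Matrix (Fin (2 * r)) (Fin (2 * r)) R :=
  Matrix.of fun i j =>
    if (j : ℕ) = (i : ℕ) + r then 1 else if (i : ℕ) = (j : ℕ) + r then -1 else 0

/-- The generic `n × n` matrix of indeterminates. -/
def Ygen (r : ℕ) (R : Type*) [CommRing R] :
    Matrix (Fin (2 * r)) (Fin (2 * r)) (MvPolynomial (Fin (2 * r) × Fin (2 * r)) R) :=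
  Matrix.of fun i j => MvPolynomial.X (i, j)

/-- The defining ideal of the scheme `V`. -/
def VIdeal (r : ℕ) (R : Type*) [CommRing R] :
    Ideal (MvPolynomial (Fin (2 * r) × Fin (2 * r)) R) :=
  Ideal.span
    ({p | ∃ i j, p = (Ygen r R + (Ygen r R)ᵀ) i j} ∪
     {p | ∃ i, p = Ygen r R i i} ∪
     {p | ∃ i j, p = ((Ygen r R)ᵀ * Jmat r (PolyRing r R) * Ygen r R) i j} ∪
     {p | ∃ k, p = (Matrix.charpoly (-(Jmat r (PolyRing r R) * Ygen r R)) - Polynomial.X ^ (2 * r)).coeff k})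

/-- The coordinate ring `R[V]`. -/
abbrev FV (r : ℕ) (R : Type*) [CommRing R] :=
  MvPolynomial (Fin (2 * r) × Fin (2 * r)) R ⧸ VIdeal r R

/-- The pfaffian of an `m × m` matrix (nonzero only for even `m`), defined as a signed sum over
permutations `σ` with `σ(2i-1) < σ(2i)` for each pair and `σ(1) < σ(3) < ⋯` (here 0-indexed). -/
def pf {m : ℕ} {R : Type*} [CommRing R] (A : Matrix (Fin m) (Fin m) R) : R :=
  ∑ σ ∈ Finset.univ.filter (fun σ : Equiv.Perm (Fin m) =>
      (∀ i : Fin (m / 2),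
        σ ⟨2 * i.val, by have := i.isLt; omega⟩ < σ ⟨2 * i.val + 1, by have := i.isLt; omega⟩) ∧
      ∀ i j : Fin (m / 2), i < j →
        σ ⟨2 * i.val, by have := i.isLt; omega⟩ < σ ⟨2 * j.val, by have := j.isLt; omega⟩),
    (Equiv.Perm.sign σ : ℤ) •
      ∏ i : Fin (m / 2),
        A (σ ⟨2 * i.val, by have := i.isLt; omega⟩) (σ ⟨2 * i.val + 1, by have := i.isLt; omega⟩)

/-- `[i₁, …, i₂ₗ]`: the pfaffian of the submatrix of `Y` given by a list of indices. -/
def listPf {n : ℕ} {R : Type*} [CommRing R] (Y : Matrix (Fin n) (Fin n) R)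
    (L : List (Fin n)) : R :=
  pf (Matrix.of fun a b : Fin L.length => Y (L.get a) (L.get b))

/-- The product of pfaffians associated to a tableau (rows as lists of entries),
as a polynomial. -/
def tabPoly (r : ℕ) (R : Type*) [CommRing R] (T : List (List (Fin (2 * r)))) :
    MvPolynomial (Fin (2 * r) × Fin (2 * r)) R :=
  (T.map (listPf (Ygen r R))).prod

/-- `[T]`, the class of the product of pfaffians of the rows of `T` in `R[V]`. -/
def tabElem (r : ℕ) (R : Type*) [CommRing R] (T : List (List (Fin (2 * r)))) : FV r R :=
  Ideal.Quotient.mk (VIdeal r R) (tabPoly r R T)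

/-- Position of an index in the order `1̄ ≺ 1 ≺ 2̄ ≺ 2 ≺ ⋯ ≺ r̄ ≺ r`, where `ī := r + i`
(0-indexed: `ī` is `r + i - 1` and `i` is `i - 1`). -/
def ordIdx (r : ℕ) (x : Fin (2 * r)) : ℕ :=
  if x.val < r then 2 * x.val + 1 else 2 * (x.val - r)

/-- A list of rows represents a tableau of shape a partition: row lengths weakly decreasing
and positive. -/
def IsShape {α : Type*} (T : List (List α)) : Prop :=
  (T.map List.length).Chain' (fun a b => b ≤ a) ∧ ∀ row ∈ T, row ≠ []

/-- An even-tableau: every row has even length. -/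
def IsEvenTab {α : Type*} (T : List (List α)) : Prop :=
  ∀ row ∈ T, Even row.length

/-- Standard: entries strictly increase along each row and weakly increase down each column,
with respect to the order `≺`. -/
def IsStandard (r : ℕ) (T : List (List (Fin (2 * r)))) : Prop :=
  (∀ row ∈ T, row.Chain' (fun a b => ordIdx r a < ordIdx r b)) ∧
  ∀ (i t : ℕ) (hi : i + 1 < T.length) (ht' : t < (T[i]'(Nat.lt_of_succ_lt hi)).length)
    (ht : t < (T[i + 1]'hi).length),
    ordIdx r ((T[i]'(Nat.lt_of_succ_lt hi))[t]'ht') ≤ ordIdx r ((T[i + 1]'hi)[t]'ht)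

/-- The symplectic condition: the entries `p` and `p̄` (0-indexed: values `p` and `r + p`
for `p < r`) occur only in the first `p + 1` columns (0-indexed: columns `t ≤ p`). -/
def IsSymplectic (r : ℕ) (T : List (List (Fin (2 * r)))) : Prop :=
  ∀ (i t : ℕ) (hi : i < T.length) (ht : t < (T[i]'hi).length) (p : ℕ), p < r →
    (((T[i]'hi)[t]'ht).val = p ∨ ((T[i]'hi)[t]'ht).val = r + p) → t ≤ p

/-- A symplectic standard even-tableau. -/
def IsSSET (r : ℕ) (T : List (List (Fin (2 * r)))) : Prop :=
  IsShape T ∧ IsEvenTab T ∧ IsStandard r T ∧ IsSymplectic r T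

/-- A canonical tableau: in column `j` only `j̄` appears (0-indexed: column `t` contains
only the value `r + t`). -/
def IsCanonical (r : ℕ) (T : List (List (Fin (2 * r)))) : Prop :=
  ∀ (i t : ℕ) (hi : i < T.length) (ht : t < (T[i]'hi).length), ((T[i]'hi)[t]'ht).val = r + t

/-- The set `V(C)` of matrices. -/
def MemV (r : ℕ) {C : Type*} [CommRing C] (Y : Matrix (Fin (2 * r)) (Fin (2 * r)) C) : Prop :=
  Y = -Yᵀ ∧ (∀ i, Y i i = 0) ∧ Yᵀ * Jmat r C * Y = 0 ∧
    Matrix.charpoly (-(Jmat r C * Y)) = Polynomial.X ^ (2 * r)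

/-- The embedding `i ↦ i` of `{1, …, r}` into `{1, …, n}`. -/
def emb (r : ℕ) (i : Fin r) : Fin (2 * r) := ⟨i.val, by have := i.isLt; omega⟩

/-- The embedding `i ↦ ī = r + i` of `{1, …, r}` into `{1, …, n}`. -/
def embBar (r : ℕ) (i : Fin r) : Fin (2 * r) := ⟨r + i.val, by have := i.isLt; omega⟩

/-- The index list of `[P, Q̄]`: with `Γ₀ = P ∩ Q = {γ₁ < ⋯ < γ_λ}`, the list
`γ₁, γ̄₁, …, γ_λ, γ̄_λ` followed by `P ∖ Γ₀` in increasing order and then the bars of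
`Q ∖ Γ₀` in increasing order. -/
def pqList (r : ℕ) (P Q : Finset (Fin r)) : List (Fin (2 * r)) :=
  ((P ∩ Q).sort (· ≤ ·)).flatMap (fun γ => [emb r γ, embBar r γ]) ++
    ((P \ Q).sort (· ≤ ·)).map (emb r) ++ ((Q \ P).sort (· ≤ ·)).map (embBar r)

/-- The pfaffian `[P, Q̄]` of the matrix `Y`. -/
def pfPQ (r : ℕ) {C : Type*} [CommRing C] (Y : Matrix (Fin (2 * r)) (Fin (2 * r)) C)
    (P Q : Finset (Fin r)) : C :=
  listPf Y (pqList r P Q)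

/-- The defining ideal of the scheme `W`. -/
def WIdeal (r : ℕ) (R : Type*) [CommRing R] : Ideal (PolyRing r R) :=
  Ideal.span
    ({p | ∃ i j, p = (Jmat r (PolyRing r R) * (Ygen r R)ᵀ * Jmat r (PolyRing r R)
            + Ygen r R) i j} ∪
     {p | ∃ i j, p = (Ygen r R * Ygen r R) i j} ∪
     {p | ∃ k, p = (Matrix.charpoly (Ygen r R) - Polynomial.X ^ (2 * r)).coeff k})

/-- The coordinate ring `R[W]`. -/
abbrev FW (r : ℕ) (R : Type*) [CommRing R] := PolyRing r R ⧸ WIdeal r R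

section PairingSum

variable {ι C : Type*} [CommRing C]

/-- The position `2i + b` of the slot `b` of the block `i`. -/
def slot {M : ℕ} (x : Fin M × Fin 2) : ℕ := 2 * x.1.val + x.2.val

lemma slot_injective {M : ℕ} : Function.Injective (slot : Fin M × Fin 2 → ℕ) := by
  rintro ⟨⟨i, hi⟩, ⟨b, hb⟩⟩ ⟨⟨j, hj⟩, ⟨c, hc⟩⟩ h
  simp only [slot] at h
  simp only [Prod.mk.injEq, Fin.mk.injEq]
  omega

lemma exists_slot_eq {M p : ℕ} (hp : p < 2 * M) : ∃ x : Fin M × Fin 2, slot x = p :=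
  ⟨(⟨p / 2, by omega⟩, ⟨p % 2, by omega⟩), by simp only [slot]; omega⟩

/-- The signed sum over all permutations of the slots of the products of the entries of `Y`
at the blocks, with indices taken from `f`. -/
def pairingSum (Y : Matrix ι ι C) (M : ℕ) (f : ℕ → ι) : C :=
  ∑ σ : Equiv.Perm (Fin M × Fin 2), (Equiv.Perm.sign σ : ℤ) •
    ∏ i, Y (f (slot (σ (i, 0)))) (f (slot (σ (i, 1))))

lemma pairingSum_swap (Y : Matrix ι ι C) {M : ℕ} {f g : ℕ → ι} {p q : ℕ} (hp : p < 2 * M)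
    (hq : q < 2 * M) (hpq : p ≠ q) (h : ∀ s, g s = f (Equiv.swap p q s)) :
    pairingSum Y M g = -pairingSum Y M f := by
  obtain ⟨x, rfl⟩ := exists_slot_eq hp
  obtain ⟨y, rfl⟩ := exists_slot_eq hq
  have hxy : x ≠ y := fun e => hpq (congrArg slot e)
  have hg : ∀ z : Fin M × Fin 2, g (slot z) = f (slot (Equiv.swap x y z)) := fun z => by
    rw [h, slot_injective.map_swap]
  unfold pairingSum
  rw [← Finset.sum_neg_distrib]
  refine Fintype.sum_equiv (Equiv.mulLeft (Equiv.swap x y)) _ _ fun σ => ?_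
  simp only [hg, Equiv.coe_mulLeft, Equiv.Perm.mul_apply, map_mul, Equiv.Perm.sign_swap hxy]
  simp

/-- A pairing sum whose terms are invariant under exchanging two slots vanishes. -/
lemma sum_sign_smul_eq_zero {X : Type*} [Fintype X] [DecidableEq X] {x y : X} (hxy : x ≠ y)
    (T : Equiv.Perm X → C) (hT : ∀ σ, T (Equiv.swap x y * σ) = T σ) :
    ∑ σ : Equiv.Perm X, (Equiv.Perm.sign σ : ℤ) • T σ = 0 := by
  refine Finset.sum_involution (fun σ _ => Equiv.swap x y * σ) ?_ ?_ ?_ ?_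
  · intro σ _
    simp [hT, Equiv.Perm.sign_swap hxy]
  · intro σ _ _ h
    have h' : Equiv.swap x y = 1 := by simpa using h
    exact hxy (Equiv.swap_eq_one_iff.1 h')
  · simp
  · intro σ _
    simp [← mul_assoc]

lemma pairingSum_eq_zero_of_eq (Y : Matrix ι ι C) {M : ℕ} {f : ℕ → ι} {p q : ℕ}
    (hp : p < 2 * M) (hq : q < 2 * M) (hpq : p ≠ q) (h : f p = f q) : pairingSum Y M f = 0 := by
  obtain ⟨x, rfl⟩ := exists_slot_eq hp
  obtain ⟨y, rfl⟩ := exists_slot_eq hq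
  refine sum_sign_smul_eq_zero (fun e => hpq (congrArg slot e)) _ fun σ => ?_
  have hf : ∀ z : Fin M × Fin 2, f (slot (Equiv.swap x y z)) = f (slot z) := fun z => by
    rcases eq_or_ne z x with rfl | hx
    · rw [Equiv.swap_apply_left, h]
    rcases eq_or_ne z y with rfl | hy
    · rw [Equiv.swap_apply_right, h]
    rw [Equiv.swap_apply_of_ne_of_ne hx hy]
  simp only [Equiv.Perm.mul_apply, hf]

section Contraction

variable {Γ : Type*} [Fintype Γ]

/-- If `Y` is skew-symmetric, has vanishing trace with respect to the pairs `(a γ, b γ)` and these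
pairs contract `Y` with itself to zero, then a sum over `γ` of products of entries of `Y` in which
`a γ` and `b γ` occur once each does not change when `a γ` and `b γ` are exchanged. -/
lemma sum_prod_exchange (Y : Matrix ι ι C) (hskew : ∀ i j, Y i j = -Y j i) (a b : Γ → ι)
    (htr : ∑ γ, Y (a γ) (b γ) = 0)
    (hcon : ∀ c d, ∑ γ, Y (a γ) c * Y (b γ) d = ∑ γ, Y (b γ) c * Y (a γ) d)
    {M : ℕ} (w : Fin M × Fin 2 → ℕ) (hw : Function.Injective w) {x y : Fin M × Fin 2}
    {p q : ℕ} (hx : w x = p) (hy : w y = q) (hpq : p ≠ q) (f g : Γ → ℕ → ι)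
    (hfp : ∀ γ, f γ p = a γ) (hfq : ∀ γ, f γ q = b γ)
    (hgp : ∀ γ, g γ p = b γ) (hgq : ∀ γ, g γ q = a γ)
    (c : ℕ → ι) (hf : ∀ γ s, s ≠ p → s ≠ q → f γ s = c s)
    (hg : ∀ γ s, s ≠ p → s ≠ q → g γ s = c s) :
    ∑ γ, ∏ i, Y (f γ (w (i, 0))) (f γ (w (i, 1))) =
      ∑ γ, ∏ i, Y (g γ (w (i, 0))) (g γ (w (i, 1))) := by
  have htr' : ∑ γ, Y (b γ) (a γ) = 0 := by
    rw [Finset.sum_congr rfl fun γ _ => hskew (b γ) (a γ), Finset.sum_neg_distrib, htr, neg_zero]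
  have hxy : x ≠ y := fun e => hpq (by rw [← hx, ← hy, e])
  have hwp : ∀ z, z ≠ x → w z ≠ p := fun z hz e => hz (hw (e.trans hx.symm))
  have hwq : ∀ z, z ≠ y → w z ≠ q := fun z hz e => hz (hw (e.trans hy.symm))
  have hf' : ∀ γ z, z ≠ x → z ≠ y → f γ (w z) = c (w z) := fun γ z h1 h2 =>
    hf γ _ (hwp z h1) (hwq z h2)
  have hg' : ∀ γ z, z ≠ x → z ≠ y → g γ (w z) = c (w z) := fun γ z h1 h2 =>
    hg γ _ (hwp z h1) (hwq z h2)
  by_cases hb : x.1 = y.1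
  · obtain ⟨i, bx⟩ := x
    obtain ⟨j, jy⟩ := y
    obtain rfl : i = j := hb
    have key : ∀ h : Γ → ℕ → ι, (∀ γ z, z ≠ (i, bx) → z ≠ (i, jy) → h γ (w z) = c (w z)) →
        ∑ γ, Y (h γ (w (i, 0))) (h γ (w (i, 1))) = 0 →
        ∑ γ, ∏ i, Y (h γ (w (i, 0))) (h γ (w (i, 1))) = 0 := by
      intro h hc h0
      have : ∀ γ, ∏ i, Y (h γ (w (i, 0))) (h γ (w (i, 1))) =
          Y (h γ (w (i, 0))) (h γ (w (i, 1))) *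
            ∏ k ∈ Finset.univ.erase i, Y (c (w (k, 0))) (c (w (k, 1))) := by
        intro γ
        rw [← Finset.mul_prod_erase _ _ (Finset.mem_univ i)]
        congr 1
        refine Finset.prod_congr rfl fun k hk => ?_
        have hk' : k ≠ i := Finset.ne_of_mem_erase hk
        rw [hc, hc] <;> simp [hk']
      rw [Finset.sum_congr rfl fun γ _ => this γ, ← Finset.sum_mul, h0, zero_mul]
    have hbj : (bx = 0 ∧ jy = 1) ∨ (bx = 1 ∧ jy = 0) := by
      have : bx ≠ jy := fun e => hxy (by rw [e])
      revert this
      clear * -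
      revert bx jy
      decide
    rw [key f hf', key g hg']
    · rcases hbj with ⟨rfl, rfl⟩ | ⟨rfl, rfl⟩ <;> simpa [hx, hy, hgp, hgq]
    · rcases hbj with ⟨rfl, rfl⟩ | ⟨rfl, rfl⟩ <;> simpa [hx, hy, hfp, hfq]
  · have hblock : ∀ z z' : Fin M × Fin 2, z.1 ≠ z'.1 → ∃ (s : C) (d : ι), ∀ h : Γ → ℕ → ι,
        (∀ γ v, v ≠ z → v ≠ z' → h γ (w v) = c (w v)) →
        ∀ γ, Y (h γ (w (z.1, 0))) (h γ (w (z.1, 1))) = s * Y (h γ (w z)) d := by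
      rintro ⟨i, bz⟩ z' hz
      have hbz : bz = 0 ∨ bz = 1 := by
        clear * -
        revert bz
        decide
      have hz' : ∀ b : Fin 2, (i, b) ≠ z' := fun b e => hz (by rw [← e])
      rcases hbz with rfl | rfl
      · refine ⟨1, c (w (i, 1)), fun h hc γ => ?_⟩
        rw [hc γ (i, 1) (by simp) (hz' _), one_mul]
      · refine ⟨-1, c (w (i, 0)), fun h hc γ => ?_⟩
        rw [hc γ (i, 0) (by simp) (hz' _), hskew]
        simp
    obtain ⟨s, d, hs⟩ := hblock x y hb
    obtain ⟨s', d', hs'⟩ := hblock y x (Ne.symm hb)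
    have key : ∀ h : Γ → ℕ → ι, (∀ γ z, z ≠ x → z ≠ y → h γ (w z) = c (w z)) →
        ∑ γ, ∏ i, Y (h γ (w (i, 0))) (h γ (w (i, 1))) =
        (∑ γ, Y (h γ p) d * Y (h γ q) d') * (s * s' *
          ∏ k ∈ (Finset.univ.erase x.1).erase y.1, Y (c (w (k, 0))) (c (w (k, 1)))) := by
      intro h hc
      rw [Finset.sum_mul]
      refine Finset.sum_congr rfl fun γ _ => ?_
      rw [← Finset.mul_prod_erase _ _ (Finset.mem_univ x.1),
        ← Finset.mul_prod_erase _ _ (Finset.mem_erase.2 ⟨Ne.symm hb, Finset.mem_univ y.1⟩),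
        hs h hc, hs' h (fun γ v h1 h2 => hc γ v h2 h1), hx, hy]
      have : ∏ k ∈ (Finset.univ.erase x.1).erase y.1, Y (h γ (w (k, 0))) (h γ (w (k, 1))) =
          ∏ k ∈ (Finset.univ.erase x.1).erase y.1, Y (c (w (k, 0))) (c (w (k, 1))) := by
        refine Finset.prod_congr rfl fun k hk => ?_
        have hky : k ≠ y.1 := Finset.ne_of_mem_erase hk
        have hkx : k ≠ x.1 := Finset.ne_of_mem_erase (Finset.mem_of_mem_erase hk)
        rw [hc, hc] <;> first
          | exact fun e => hkx (congrArg Prod.fst e)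
          | exact fun e => hky (congrArg Prod.fst e)
      rw [this]
      ring
    rw [key f hf', key g hg']
    simp only [hfp, hfq, hgp, hgq, hcon]

/-- Contracting a pairing sum with pairs as in `sum_prod_exchange` gives zero. -/
lemma sum_pairingSum_eq_zero (Y : Matrix ι ι C) (hskew : ∀ i j, Y i j = -Y j i) (a b : Γ → ι)
    (htr : ∑ γ, Y (a γ) (b γ) = 0)
    (hcon : ∀ c d, ∑ γ, Y (a γ) c * Y (b γ) d = ∑ γ, Y (b γ) c * Y (a γ) d)
    {M : ℕ} (hM : 0 < M) (f : Γ → ℕ → ι) (c : ℕ → ι) (hf0 : ∀ γ, f γ 0 = a γ)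
    (hf1 : ∀ γ, f γ 1 = b γ) (hf : ∀ γ s, s ≠ 0 → s ≠ 1 → f γ s = c s) :
    ∑ γ, pairingSum Y M (f γ) = 0 := by
  obtain ⟨x, hx⟩ := exists_slot_eq (M := M) (p := 0) (by omega)
  obtain ⟨y, hy⟩ := exists_slot_eq (M := M) (p := 1) (by omega)
  have hxy : x ≠ y := by
    rintro rfl
    omega
  unfold pairingSum
  rw [Finset.sum_comm]
  simp only [← Finset.smul_sum]
  refine sum_sign_smul_eq_zero hxy _ fun σ => ?_
  have hsw : ∀ z : Fin M × Fin 2, slot (Equiv.swap x y z) = Equiv.swap 0 1 (slot z) := fun z => by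
    rw [slot_injective.map_swap, hx, hy]
  simp only [Equiv.Perm.mul_apply, hsw]
  refine (sum_prod_exchange Y hskew a b htr hcon (fun z => slot (σ z))
    (slot_injective.comp σ.injective) (x := σ.symm x) (y := σ.symm y) (p := 0) (q := 1)
    (by simpa) (by simpa) (by simp) f (fun γ s => f γ (Equiv.swap 0 1 s)) hf0 hf1
    (by simpa) (by simpa) c hf ?_).symm
  intro γ s h0 h1
  rw [Equiv.swap_apply_of_ne_of_ne h0 h1, hf γ s h0 h1]

end Contraction

end PairingSum

section Pfaffian

variable {C : Type*} [CommRing C]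

/-- The permutation `(i, b) ↦ (π i, ε (π i) b)` of the slots. -/
def blockPerm {M : ℕ} (ε : Fin M → Equiv.Perm (Fin 2)) (π : Equiv.Perm (Fin M)) :
    Equiv.Perm (Fin M × Fin 2) :=
  Equiv.prodCongrRight ε * Equiv.prodCongrLeft fun _ => π

@[simp]
lemma blockPerm_apply {M : ℕ} (ε : Fin M → Equiv.Perm (Fin 2)) (π : Equiv.Perm (Fin M))
    (i : Fin M) (b : Fin 2) : blockPerm ε π (i, b) = (π i, ε (π i) b) := rfl

lemma sign_blockPerm {M : ℕ} (ε : Fin M → Equiv.Perm (Fin 2)) (π : Equiv.Perm (Fin M)) :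
    Equiv.Perm.sign (blockPerm ε π) = ∏ i, Equiv.Perm.sign (ε i) := by
  rw [blockPerm, map_mul, Equiv.Perm.sign_prodCongrRight, Equiv.Perm.sign_prodCongrLeft]
  simp

/-- An arrangement of the slots is sorted if it increases inside each block and the first slots
of the blocks increase. -/
def IsSortedArrangement {M k : ℕ} (w : Fin M × Fin 2 → Fin k) : Prop :=
  (∀ i, w (i, 0) < w (i, 1)) ∧ ∀ i j, i < j → w (i, 0) < w (j, 0)

lemma existsUnique_isSortedArrangement {M k : ℕ} {w : Fin M × Fin 2 → Fin k}
    (hw : Function.Injective w) :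
    ∃! p : (Fin M → Equiv.Perm (Fin 2)) × Equiv.Perm (Fin M),
      IsSortedArrangement (w ∘ blockPerm p.1 p.2) := by
  have hε : ∀ j, ∃! e : Equiv.Perm (Fin 2), w (j, e 0) < w (j, e 1) := by
    intro j
    have hne : w (j, 0) ≠ w (j, 1) := fun e => by simpa using hw e
    have hall : ∀ e : Equiv.Perm (Fin 2), e = 1 ∨ e = Equiv.swap 0 1 := by decide
    rcases lt_or_gt_of_ne hne with h | h
    · refine ⟨1, by simpa, fun e he => ?_⟩
      rcases hall e with rfl | rfl
      · rfl
      · simp only [Equiv.swap_apply_left, Equiv.swap_apply_right] at he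
        exact absurd he h.not_gt
    · refine ⟨Equiv.swap 0 1, by simpa, fun e he => ?_⟩
      rcases hall e with rfl | rfl
      · exact absurd he h.not_gt
      · rfl
  choose ε hlt huniq using hε
  have hinj : Function.Injective fun j => w (j, ε j 0) := fun i j h => (Prod.mk.inj (hw h)).1
  refine ⟨(ε, Tuple.sort fun j => w (j, ε j 0)), ⟨fun i => hlt _, fun i j hij => ?_⟩, ?_⟩
  · exact (Tuple.monotone_sort _).strictMono_of_injective
      (hinj.comp (Equiv.injective _)) hij
  · rintro ⟨ε', π⟩ ⟨h1, h2⟩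
    obtain rfl : ε' = ε := by
      funext j
      refine huniq j _ ?_
      have := h1 (π.symm j)
      simpa using this
    refine Prod.ext rfl ?_
    refine Tuple.eq_sort_iff.2 ⟨StrictMono.monotone fun i j hij => h2 i j hij, ?_⟩
    intro i j hij h
    exact absurd (π.injective (hinj h)) hij.ne

lemma skew_apply_perm {k : ℕ} {A : Matrix (Fin k) (Fin k) C} (hA : ∀ i j, A i j = -A j i)
    (v : Fin 2 → Fin k) (e : Equiv.Perm (Fin 2)) :
    A (v (e 0)) (v (e 1)) = (Equiv.Perm.sign e : ℤ) • A (v 0) (v 1) := by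
  have hall : ∀ e : Equiv.Perm (Fin 2), e = 1 ∨ e = Equiv.swap 0 1 := by decide
  rcases hall e with rfl | rfl
  · simp
  · rw [Equiv.swap_apply_left, Equiv.swap_apply_right, hA, Equiv.Perm.sign_swap (by simp)]
    simp

/-- The full signed sum over all permutations of the slots is `2 ^ M * M!` times the sum over the
sorted ones. -/
lemma sum_perm_eq_sum_sorted {M k : ℕ} (e : Fin M × Fin 2 ≃ Fin k) {A : Matrix (Fin k) (Fin k) C}
    (hA : ∀ i j, A i j = -A j i) (S : Finset (Equiv.Perm (Fin k)))
    (hS : ∀ σ, σ ∈ S ↔ IsSortedArrangement (σ ∘ e)) :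
    ∑ σ : Equiv.Perm (Fin k), (Equiv.Perm.sign σ : ℤ) • ∏ i, A (σ (e (i, 0))) (σ (e (i, 1))) =
      ((2 ^ M * M.factorial : ℕ) : C) *
        ∑ σ ∈ S, (Equiv.Perm.sign σ : ℤ) • ∏ i, A (σ (e (i, 0))) (σ (e (i, 1))) := by
  classical
  set G : Equiv.Perm (Fin k) → C :=
    fun σ => (Equiv.Perm.sign σ : ℤ) • ∏ i, A (σ (e (i, 0))) (σ (e (i, 1))) with hG
  let act : (Fin M → Equiv.Perm (Fin 2)) × Equiv.Perm (Fin M) → Equiv.Perm (Fin k) :=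
    fun p => e.permCongr (blockPerm p.1 p.2)
  have hact : ∀ (σ : Equiv.Perm (Fin k)) p z, (σ * act p) (e z) = σ (e (blockPerm p.1 p.2 z)) := by
    intro σ p z
    simp [act, Equiv.permCongr_apply]
  have hinv : ∀ σ p, G (σ * act p) = G σ := by
    rintro σ ⟨ε, π⟩
    simp only [hG, hact, blockPerm_apply]
    rw [map_mul, Equiv.Perm.sign_permCongr, sign_blockPerm,
      Equiv.prod_comp π fun j => A (σ (e (j, ε j 0))) (σ (e (j, ε j 1))),
      Finset.prod_congr rfl fun j _ => skew_apply_perm hA (fun b => σ (e (j, b))) (ε j),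
      Finset.prod_smul, smul_smul]
    congr 1
    push_cast
    rw [mul_assoc, ← Finset.prod_mul_distrib]
    simp [← Units.val_mul]
  have hone : ∀ σ, ∑ p, (if σ * act p ∈ S then G σ else 0) = G σ := by
    intro σ
    obtain ⟨p, hp, hu⟩ := existsUnique_isSortedArrangement (σ.injective.comp e.injective)
    have hiff : ∀ p', σ * act p' ∈ S ↔ IsSortedArrangement ((σ ∘ e) ∘ blockPerm p'.1 p'.2) := by
      intro p'
      rw [hS, show ((σ * act p' : Equiv.Perm (Fin k)) ∘ e : Fin M × Fin 2 → Fin k) =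
        (σ ∘ e) ∘ blockPerm p'.1 p'.2 from funext fun z => hact σ p' z]
    rw [Finset.sum_eq_single p, if_pos ((hiff p).2 hp)]
    · intro p' _ hp'
      rw [if_neg fun h => hp' (hu p' ((hiff p').1 h))]
    · simp
  calc ∑ σ, G σ = ∑ σ, ∑ p, (if σ * act p ∈ S then G σ else 0) :=
        Finset.sum_congr rfl fun σ _ => (hone σ).symm
    _ = ∑ p, ∑ σ, (if σ * act p ∈ S then G (σ * act p) else 0) := by
        rw [Finset.sum_comm]
        simp only [hinv]
    _ = ∑ _p : (Fin M → Equiv.Perm (Fin 2)) × Equiv.Perm (Fin M), ∑ σ ∈ S, G σ := by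
        refine Finset.sum_congr rfl fun p _ => ?_
        refine (Equiv.sum_comp (Equiv.mulRight (act p)) fun σ => if σ ∈ S then G σ else 0).trans ?_
        rw [← Finset.sum_filter]
        simp
    _ = _ := by
        simp [Fintype.card_perm]

/-- The bijection `(i, b) ↦ 2i + b` from the slots to the positions. -/
def slotEquiv {k : ℕ} (hk : 2 * (k / 2) = k) : Fin (k / 2) × Fin 2 ≃ Fin k :=
  finProdFinEquiv.trans (finCongr (by omega))

lemma slotEquiv_val {k : ℕ} (hk : 2 * (k / 2) = k) (x : Fin (k / 2) × Fin 2) :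
    (slotEquiv hk x).val = slot x := by
  simp [slotEquiv, slot, add_comm]

lemma pairingSum_eq_pf {ι : Type*} {Y : Matrix ι ι C} (hY : ∀ i j, Y i j = -Y j i) {k : ℕ}
    (hk : 2 * (k / 2) = k) (f : ℕ → ι) :
    pairingSum Y (k / 2) f = ((2 ^ (k / 2) * (k / 2).factorial : ℕ) : C) *
      pf (Matrix.of fun a b : Fin k => Y (f a) (f b)) := by
  have h0 : ∀ i : Fin (k / 2), (⟨2 * i.val, by omega⟩ : Fin k) = slotEquiv hk (i, 0) :=
    fun i => Fin.ext (by simp [slotEquiv_val, slot])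
  have h1 : ∀ i : Fin (k / 2), (⟨2 * i.val + 1, by omega⟩ : Fin k) = slotEquiv hk (i, 1) :=
    fun i => Fin.ext (by simp [slotEquiv_val, slot])
  simp only [pf, h0, h1]
  rw [← sum_perm_eq_sum_sorted (slotEquiv hk) (A := Matrix.of fun a b : Fin k => Y (f a) (f b))
    (fun i j => hY _ _) _ fun σ => by simp [IsSortedArrangement]]
  refine Fintype.sum_equiv (slotEquiv hk).permCongr _ _ fun σ => ?_
  simp [Equiv.Perm.sign_permCongr, Equiv.permCongr_apply, slotEquiv_val]

end Pfaffian

section ListPairingSum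

variable {ι C : Type*} [Inhabited ι] [CommRing C]

/-- The pairing sum along a list of indices. -/
def listPairingSum (Y : Matrix ι ι C) (L : List ι) : C :=
  pairingSum Y (L.length / 2) fun p => L.getD p default

lemma listPairingSum_swap (Y : Matrix ι ι C) (U R : List ι) (a b : ι)
    (h : 2 * ((U ++ a :: b :: R).length / 2) = (U ++ a :: b :: R).length) :
    listPairingSum Y (U ++ b :: a :: R) = -listPairingSum Y (U ++ a :: b :: R) := by
  have hlen : (U ++ b :: a :: R).length = (U ++ a :: b :: R).length := by simp
  unfold listPairingSum
  rw [hlen]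
  refine pairingSum_swap Y (p := U.length) (q := U.length + 1) ?_ ?_ (by simp) fun s => ?_
  · rw [h]
    simp
  · rw [h]
    simp
  rcases lt_trichotomy s U.length with hs | rfl | hs
  · rw [Equiv.swap_apply_of_ne_of_ne (by omega) (by omega), List.getD_append _ _ _ _ hs,
      List.getD_append _ _ _ _ hs]
  · simp
  · obtain ⟨d, rfl⟩ : ∃ d, s = U.length + 1 + d := ⟨s - U.length - 1, by omega⟩
    rcases d with _ | d
    · simp
    · rw [Equiv.swap_apply_of_ne_of_ne (by omega) (by omega),
        List.getD_append_right _ _ _ _ (by omega), List.getD_append_right _ _ _ _ (by omega),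
        show U.length + 1 + (d + 1) - U.length = d + 2 by omega]
      rfl

lemma listPairingSum_swap_pairs (Y : Matrix ι ι C) (U R : List ι) (a b c d : ι)
    (h : Even (U ++ a :: b :: c :: d :: R).length) :
    listPairingSum Y (U ++ c :: d :: a :: b :: R) =
      listPairingSum Y (U ++ a :: b :: c :: d :: R) := by
  have hU : Even (U.length + R.length) := by
    simp only [List.length_append, List.length_cons] at h
    grind
  have h1 := listPairingSum_swap Y (U ++ [a]) (d :: R) b c (by simp; grind)
  have h2 := listPairingSum_swap Y U (b :: d :: R) a c (by simp; grind)
  have h3 := listPairingSum_swap Y (U ++ [c, a]) R b d (by simp; grind)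
  have h4 := listPairingSum_swap Y (U ++ [c]) (b :: R) a d (by simp; grind)
  simp only [List.append_assoc, List.cons_append, List.nil_append] at h1 h2 h3 h4
  rw [h4, h3, h2, h1]
  simp

lemma listPairingSum_perm_pairs {α : Type*} (Y : Matrix ι ι C) (a b : α → ι) {l l' : List α}
    (h : l.Perm l') (U R : List ι) (hUR : Even (U.length + R.length)) :
    listPairingSum Y (U ++ l.flatMap (fun γ => [a γ, b γ]) ++ R) =
      listPairingSum Y (U ++ l'.flatMap (fun γ => [a γ, b γ]) ++ R) := by
  induction h generalizing U with
  | nil => rfl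
  | cons x _ ih =>
    have := ih (U ++ [a x, b x]) (by simp; grind)
    simpa using this
  | swap x y l =>
    have := listPairingSum_swap_pairs Y U (l.flatMap (fun γ => [a γ, b γ]) ++ R)
      (a x) (b x) (a y) (b y) (by simp; grind)
    simpa using this
  | trans _ _ ih1 ih2 => exact (ih1 U hUR).trans (ih2 U hUR)

lemma listPairingSum_eq_zero_of_not_nodup (Y : Matrix ι ι C) {L : List ι} (hL : Even L.length)
    (h : ¬L.Nodup) : listPairingSum Y L = 0 := by
  rw [List.nodup_iff_injective_get, Function.Injective] at h
  push Not at h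
  obtain ⟨i, j, hij, hne⟩ := h
  have := Nat.two_mul_div_two_of_even hL
  refine pairingSum_eq_zero_of_eq Y (p := i.val) (q := j.val) (by omega) (by omega)
    (fun e => hne (Fin.ext e)) ?_
  simpa using hij

lemma listPairingSum_eq_listPf {n : ℕ} [NeZero n] {Y : Matrix (Fin n) (Fin n) C}
    (hY : ∀ i j, Y i j = -Y j i) {L : List (Fin n)} {m : ℕ} (hL : L.length = 2 * m) :
    listPairingSum Y L = ((2 ^ m * m.factorial : ℕ) : C) * listPf Y L := by
  obtain rfl : m = L.length / 2 := by omega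
  rw [listPairingSum, pairingSum_eq_pf hY (by omega)]
  simp [listPf]

end ListPairingSum

section Symplectic

variable {r : ℕ} {C : Type*} [CommRing C]

lemma sum_eq_sum_emb_add_embBar (g : Fin (2 * r) → C) :
    ∑ x, g x = ∑ i, (g (emb r i) + g (embBar r i)) := by
  rw [Finset.sum_add_distrib, ← Equiv.sum_comp (finCongr (two_mul r).symm), Fin.sum_univ_add]
  rfl

lemma Jmat_mul_emb (Y : Matrix (Fin (2 * r)) (Fin (2 * r)) C) (i : Fin r) (x : Fin (2 * r)) :
    (Jmat r C * Y) (emb r i) x = Y (embBar r i) x := by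
  rw [Matrix.mul_apply, Finset.sum_eq_single (embBar r i)]
  · simp [Jmat, emb, embBar, add_comm]
  · intro j _ hj
    have h1 : (j : ℕ) ≠ i.val + r := fun e => hj (Fin.ext (by simp [embBar]; omega))
    have h2 : i.val ≠ j + r := by omega
    simp [Jmat, emb, h1, h2]
  · simp

lemma Jmat_mul_embBar (Y : Matrix (Fin (2 * r)) (Fin (2 * r)) C) (i : Fin r) (x : Fin (2 * r)) :
    (Jmat r C * Y) (embBar r i) x = -Y (emb r i) x := by
  rw [Matrix.mul_apply, Finset.sum_eq_single (emb r i)]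
  · have h1 : i.val ≠ i + r + r := by omega
    have h2 : r + i.val = i + r := by omega
    simp [Jmat, emb, embBar, h1, h2]
  · intro j _ hj
    have h1 : (j : ℕ) ≠ i.val := fun e => hj (Fin.ext e)
    have h2 : (j : ℕ) ≠ r + i + r := by omega
    have h3 : r + i.val ≠ j + r := by omega
    simp [Jmat, embBar, h2, h3]
  · simp

lemma MemV.skew {Y : Matrix (Fin (2 * r)) (Fin (2 * r)) C} (hY : MemV r Y) (i j : Fin (2 * r)) :
    Y i j = -Y j i :=
  congrFun (congrFun hY.1 i) j

lemma MemV.contraction {Y : Matrix (Fin (2 * r)) (Fin (2 * r)) C} (hY : MemV r Y)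
    (c d : Fin (2 * r)) :
    ∑ i, Y (emb r i) c * Y (embBar r i) d = ∑ i, Y (embBar r i) c * Y (emb r i) d := by
  have h := congrFun (congrFun hY.2.2.1 c) d
  rw [Matrix.mul_assoc, Matrix.mul_apply, sum_eq_sum_emb_add_embBar] at h
  simp only [Jmat_mul_emb, Jmat_mul_embBar, Matrix.transpose_apply, Matrix.zero_apply,
    Finset.sum_add_distrib, mul_neg, Finset.sum_neg_distrib] at h
  linear_combination h

lemma MemV.two_mul_sum {Y : Matrix (Fin (2 * r)) (Fin (2 * r)) C} (hr : 2 ≤ r)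
    (hY : MemV r Y) : 2 * ∑ i, Y (emb r i) (embBar r i) = 0 := by
  nontriviality C
  have : Nonempty (Fin (2 * r)) := ⟨⟨0, by omega⟩⟩
  have h : Matrix.trace (-(Jmat r C * Y)) = 0 := by
    rw [Matrix.trace_eq_neg_charpoly_coeff, hY.2.2.2, Polynomial.coeff_X_pow]
    rw [if_neg (by simp; omega), neg_zero]
  rw [Matrix.trace_neg, neg_eq_zero, Matrix.trace, sum_eq_sum_emb_add_embBar] at h
  simp only [Matrix.diag_apply, Jmat_mul_emb, Jmat_mul_embBar, Finset.sum_add_distrib,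
    Finset.sum_neg_distrib] at h
  rw [Finset.sum_congr rfl fun i _ => hY.skew (embBar r i) (emb r i),
    Finset.sum_neg_distrib] at h
  linear_combination -h

lemma length_pqList (P Q : Finset (Fin r)) : (pqList r P Q).length = P.card + Q.card := by
  have h1 := Finset.card_inter_add_card_sdiff P Q
  have h2 := Finset.card_inter_add_card_sdiff Q P
  rw [Finset.inter_comm] at h2
  simp only [pqList, List.length_append, List.length_flatMap, List.length_map,
    Finset.length_sort, List.length_cons, List.length_nil, List.map_const', List.sum_replicate]
  simp only [smul_eq_mul]
  omega

lemma mem_pqList_of_mem_union {P Q : Finset (Fin r)} {γ : Fin r} (h : γ ∈ P ∪ Q) :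
    emb r γ ∈ pqList r P Q ∨ embBar r γ ∈ pqList r P Q := by
  simp only [pqList, List.mem_append, List.mem_flatMap, List.mem_map, Finset.mem_sort,
    Finset.mem_inter, Finset.mem_sdiff]
  rw [Finset.mem_union] at h
  by_cases hP : γ ∈ P
  · by_cases hQ : γ ∈ Q
    · exact Or.inl (Or.inl (Or.inl ⟨γ, ⟨hP, hQ⟩, by simp⟩))
    · exact Or.inl (Or.inl (Or.inr ⟨γ, ⟨hP, hQ⟩, rfl⟩))
  · exact Or.inr (Or.inr ⟨γ, ⟨h.resolve_left hP, hP⟩, rfl⟩)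

variable [NeZero (2 * r)]

lemma listPairingSum_pqList_insert (Y : Matrix (Fin (2 * r)) (Fin (2 * r)) C)
    {P Q : Finset (Fin r)} (hPQ : Even (P.card + Q.card)) {γ : Fin r} (hγ : γ ∉ P ∪ Q) :
    listPairingSum Y (pqList r (insert γ P) (insert γ Q)) =
      listPairingSum Y (emb r γ :: embBar r γ :: pqList r P Q) := by
  rw [Finset.mem_union, not_or] at hγ
  have hperm : ((insert γ P ∩ insert γ Q).sort (· ≤ ·)).Perm
      (γ :: (P ∩ Q).sort (· ≤ ·)) := by
    rw [← Finset.insert_inter_distrib]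
    refine (Finset.sort_perm_toList _ _).trans ((Finset.toList_insert ?_).trans
      ((Finset.sort_perm_toList _ _).symm.cons _))
    simp [hγ.1]
  have h1 : insert γ P \ insert γ Q = P \ Q := by
    ext x
    simp only [Finset.mem_sdiff, Finset.mem_insert]
    grind
  have h2 : insert γ Q \ insert γ P = Q \ P := by
    ext x
    simp only [Finset.mem_sdiff, Finset.mem_insert]
    grind
  have hlen := length_pqList P Q
  simp only [pqList, List.append_assoc, List.length_append, List.length_map] at hlen
  have h := listPairingSum_perm_pairs Y (emb r) (embBar r) hperm []
    (((P \ Q).sort (· ≤ ·)).map (emb r) ++ ((Q \ P).sort (· ≤ ·)).map (embBar r)) (by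
      have hflat : Even (((P ∩ Q).sort (· ≤ ·)).flatMap
          fun γ => [emb r γ, embBar r γ]).length := by
        simp [List.length_flatMap]
      rw [← hlen, Nat.even_add] at hPQ
      simpa using hPQ.1 hflat)
  unfold pqList
  rw [h1, h2]
  simpa using h

/-- The sum of the pairing sums over all ways of adding one pair `γ, γ̄` vanishes. -/
lemma MemV.sum_insert_eq_zero {Y : Matrix (Fin (2 * r)) (Fin (2 * r)) C} (hY : MemV r Y)
    (htr : ∑ i, Y (emb r i) (embBar r i) = 0) {P Q : Finset (Fin r)}
    (hPQ : Even (P.card + Q.card)) :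
    ∑ γ ∈ Finset.univ \ (P ∪ Q),
      listPairingSum Y (pqList r (insert γ P) (insert γ Q)) = 0 := by
  rw [Finset.sum_congr rfl fun γ hγ =>
    listPairingSum_pqList_insert Y hPQ (Finset.mem_sdiff.1 hγ).2]
  rw [Finset.sum_subset (Finset.subset_univ _)]
  · simp only [listPairingSum, List.length_cons]
    exact sum_pairingSum_eq_zero Y hY.skew (emb r) (embBar r) htr hY.contraction (by omega) _
      (fun p => (pqList r P Q).getD (p - 2) default) (fun γ => rfl) (fun γ => rfl)
      (fun γ s h0 h1 => by
        obtain ⟨s, rfl⟩ : ∃ d, s = d + 2 := ⟨s - 2, by omega⟩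
        rfl)
  · intro γ _ hγ
    have hmem := mem_pqList_of_mem_union (P := P) (Q := Q) (γ := γ) (by
      by_contra h
      exact hγ (Finset.mem_sdiff.2 ⟨Finset.mem_univ _, h⟩))
    refine listPairingSum_eq_zero_of_not_nodup Y ?_ ?_
    · simp only [List.length_cons, length_pqList]
      grind
    · simp only [List.nodup_cons, List.mem_cons]
      tauto

end Symplectic

/-- Summing over the `(s + 1)`-subsets of `U` and over their elements is the same as summing over the
`s`-subsets and the elements outside of them. -/
lemma card_nsmul_sum_powersetCard_succ {α A : Type*} [DecidableEq α] [AddCommMonoid A]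
    (U : Finset α) (s : ℕ) (G : Finset α → A) :
    (s + 1) • ∑ Γ ∈ U.powersetCard (s + 1), G Γ =
      ∑ Δ ∈ U.powersetCard s, ∑ γ ∈ U \ Δ, G (insert γ Δ) := by
  have h : (s + 1) • ∑ Γ ∈ U.powersetCard (s + 1), G Γ =
      ∑ Γ ∈ U.powersetCard (s + 1), ∑ _γ ∈ Γ, G Γ := by
    rw [Finset.smul_sum]
    refine Finset.sum_congr rfl fun Γ hΓ => ?_
    rw [Finset.sum_const, (Finset.mem_powersetCard.1 hΓ).2]
  rw [h, Finset.sum_sigma', Finset.sum_sigma']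
  refine Finset.sum_bij' (fun x _ => ⟨x.1.erase x.2, x.2⟩) (fun x _ => ⟨insert x.2 x.1, x.2⟩)
    ?_ ?_ ?_ ?_ ?_
  · rintro ⟨Γ, γ⟩ hx
    simp only [Finset.mem_sigma, Finset.mem_powersetCard, Finset.mem_sdiff] at hx ⊢
    refine ⟨⟨(Finset.erase_subset _ _).trans hx.1.1, ?_⟩, hx.1.1 hx.2, by simp⟩
    rw [Finset.card_erase_of_mem hx.2, hx.1.2, Nat.add_sub_cancel]
  · rintro ⟨Δ, γ⟩ hx
    simp only [Finset.mem_sigma, Finset.mem_powersetCard, Finset.mem_sdiff] at hx ⊢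
    refine ⟨⟨Finset.insert_subset hx.2.1 hx.1.1, ?_⟩, by simp⟩
    rw [Finset.card_insert_of_notMem hx.2.2, hx.1.2]
  · rintro ⟨Γ, γ⟩ hx
    simp only [Finset.mem_sigma] at hx
    simp [Finset.insert_erase hx.2]
  · rintro ⟨Δ, γ⟩ hx
    simp only [Finset.mem_sigma, Finset.mem_sdiff] at hx
    simp [Finset.erase_insert hx.2.2]
  · rintro ⟨Γ, γ⟩ hx
    simp only [Finset.mem_sigma] at hx
    simp [Finset.insert_erase hx.2]

/-- For `Y ∈ V(C)` over an `F`-algebra `C`, `k = 2m` with `1 ≤ t ≤ m ≤ r`,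
and `P', Q' ⊆ {1,…,r}` with `|P'| + |Q'| = k − 2t`, we have
`2^m · m! · t! · ∑_{Γₜ} [P' ∪ Γₜ, Q̄' ∪ Γ̄ₜ] = 0`, the sum over all size-`t` subsets
`Γₜ ⊆ {1,…,r} ∖ (P' ∪ Q')`. -/
theorem pfaffian_sum_vanishes (r : ℕ) (hn : 4 ≤ 2 * r) (F : Type*) [Field F]
    (C : Type*) [CommRing C] [Algebra F C]
    (Y : Matrix (Fin (2 * r)) (Fin (2 * r)) C) (hY : MemV r Y)
    (m t : ℕ) (ht1 : 1 ≤ t) (htm : t ≤ m) (hmr : m ≤ r)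
    (P' Q' : Finset (Fin r)) (hcard : P'.card + Q'.card = 2 * m - 2 * t) :
    ((2 ^ m * Nat.factorial m * Nat.factorial t : ℕ) : C) *
      ∑ Γt ∈ (Finset.univ \ (P' ∪ Q')).powerset.filter (fun s => s.card = t),
        pfPQ r Y (P' ∪ Γt) (Q' ∪ Γt) = 0 := by
  obtain ⟨s, rfl⟩ : ∃ s, t = s + 1 := ⟨t - 1, by omega⟩
  have : NeZero (2 * r) := ⟨by omega⟩
  by_cases h2 : (2 : F) = 0
  · have h2C : (2 : C) = 0 := by
      rw [← map_ofNat (algebraMap F C) 2, h2, map_zero]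
    push_cast
    rw [h2C, zero_pow (by omega), zero_mul, zero_mul, zero_mul]
  have hunit : IsUnit (2 : C) := by
    rw [← map_ofNat (algebraMap F C) 2]
    exact (IsUnit.mk0 _ h2).map (algebraMap F C)
  have htr : ∑ i, Y (emb r i) (embBar r i) = 0 :=
    hunit.mul_right_eq_zero.1 (MemV.two_mul_sum (by omega) hY)
  have hU : (Finset.univ \ (P' ∪ Q')).powerset.filter (fun Γ => Γ.card = s + 1) =
      (Finset.univ \ (P' ∪ Q')).powersetCard (s + 1) := by
    ext Γ
    simp [Finset.mem_powersetCard]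
  have hdisj : ∀ (k : ℕ), ∀ Γ ∈ (Finset.univ \ (P' ∪ Q')).powersetCard k,
      (P' ∪ Γ).card + (Q' ∪ Γ).card = P'.card + Q'.card + 2 * k := by
    intro k Γ hΓ
    obtain ⟨hsub, hk⟩ := Finset.mem_powersetCard.1 hΓ
    have hd : Disjoint (P' ∪ Q') Γ := Finset.disjoint_of_subset_right hsub Finset.disjoint_sdiff
    rw [Finset.disjoint_union_left] at hd
    rw [Finset.card_union_of_disjoint hd.1, Finset.card_union_of_disjoint hd.2, hk]
    omega
  have hpf : ∀ Γ ∈ (Finset.univ \ (P' ∪ Q')).powersetCard (s + 1),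
      ((2 ^ m * m.factorial : ℕ) : C) * pfPQ r Y (P' ∪ Γ) (Q' ∪ Γ) =
        listPairingSum Y (pqList r (P' ∪ Γ) (Q' ∪ Γ)) := fun Γ hΓ =>
    (listPairingSum_eq_listPf hY.skew (by rw [length_pqList, hdisj _ Γ hΓ]; omega)).symm
  have hsum : (s + 1) • ∑ Γ ∈ (Finset.univ \ (P' ∪ Q')).powersetCard (s + 1),
      listPairingSum Y (pqList r (P' ∪ Γ) (Q' ∪ Γ)) = 0 := by
    rw [card_nsmul_sum_powersetCard_succ]
    refine Finset.sum_eq_zero fun Δ hΔ => ?_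
    have hset : (Finset.univ \ (P' ∪ Q')) \ Δ = Finset.univ \ ((P' ∪ Δ) ∪ (Q' ∪ Δ)) := by
      ext x
      simp only [Finset.mem_sdiff, Finset.mem_union]
      tauto
    rw [hset]
    simp only [Finset.union_insert]
    exact hY.sum_insert_eq_zero htr ⟨m - 1, by rw [hdisj _ Δ hΔ]; omega⟩
  rw [hU, show 2 ^ m * m.factorial * (s + 1).factorial =
    s.factorial * ((s + 1) * (2 ^ m * m.factorial)) by rw [Nat.factorial_succ]; ring]
  rw [Nat.cast_mul, Nat.cast_mul, mul_assoc, mul_assoc, Finset.mul_sum,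
    Finset.sum_congr rfl hpf, ← nsmul_eq_mul, ← nsmul_eq_mul, hsum, nsmul_zero]

end PR
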